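/- Assume additionally j + k ≤ m − 1 (unitary minimal model). For all real x with 0 < x < 1 and all real y > 0, the following identity of convergent series holds: 1 − Σ_{n=0}^∞ x^{k+n((n+1)m+j+k)}·y/(1 + x^{k+nm}·y) − Σ_{n=0}^∞ x^{j+n((n+1)m+j+k)}·y⁻¹/(1 + x^{j+nm}·y⁻¹) − Σ_{n=1}^∞ x^{n(nm−j−k)} + Σ_{n=1}^∞ x^{k+(n+1)(nm−j−k)}·y/(1 + x^{nm−j}·y) + Σ_{n=1}^∞ x^{j+(n+1)(nm−j−k)}·y⁻¹/(1 + x^{nm−k}·y⁻¹) + Σ_{n=1}^∞ x^{n(nm+j+k)} = 1 + Σ_{n=0}^∞ x^{n²m}·(x^{n(j+k)} − x^{−n(j+k)}) + Σ_{n=0}^∞ x^{n(n+1)m−j}·y·( x^{2(n+1)m−(n+1)(j+k)}/(1 + x^{(n+1)m−j}·y) − x^{(n+1)(j+k)}/(1 + x^{k+nm}·y) ) + Σ_{n=0}^∞ x^{n(n+1)m−k}·y⁻¹·( x^{2(n+1)m−(n+1)(j+k)}/(1 + x^{(n+1)m−k}·y⁻¹) − x^{(n+1)(j+k)}/(1 +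 x^{j+nm}·y⁻¹) ). (This is the identity between the inclusion–exclusion sum over the embedding diagram and the closed character formula, Eq. (17) of the paper; the right-hand side, multiplied by the free partition function, is the character of the unitary minimal model.) -/

import Mathlib

theorem summable_rpow_of_natCast_le {x : ℝ} (hx0 : 0 < x) (hx1 : x < 1) {f : ℕ → ℝ}
    (hf : ∀ n : ℕ, (n : ℝ) ≤ f n) : Summable fun n => x ^ f n := by
  refine Summable.of_nonneg_of_le (fun n => (Real.rpow_pos_of_pos hx0 _).le) (fun n => ?_)
    (summable_geometric_of_lt_one hx0.le hx1)
  rw [← Real.rpow_natCast]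
  exact Real.rpow_le_rpow_of_exponent_ge hx0 hx1.le (hf n)

theorem summable_rpow_mul_div_one_add {x c : ℝ} (hx0 : 0 < x) (hx1 : x < 1) (hc : 0 < c)
    {f : ℕ → ℝ} (g : ℕ → ℝ) (hf : ∀ n : ℕ, (n : ℝ) ≤ f n) :
    Summable fun n => x ^ f n * c / (1 + x ^ g n * c) := by
  refine Summable.of_nonneg_of_le (fun n => by positivity) (fun n => ?_)
    ((summable_rpow_of_natCast_le hx0 hx1 hf).mul_right c)
  have hg : 0 < x ^ g n * c := by positivity
  exact div_le_self (by positivity) (by linarith)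

/-- The terms of the two series attached to one family of charged singular vectors combine
into a single series of the closed character formula. -/
theorem tsum_charged_sub {m j k x c : ℝ} (hj : 0 < j) (hk : 0 < k) (hjk : j + k ≤ m - 1)
    (hx0 : 0 < x) (hx1 : x < 1) (hc : 0 < c) :
    (∑' n : ℕ, x ^ ((n : ℝ) * ((n : ℝ) + 1) * m - j) * c *
        (x ^ (2 * ((n : ℝ) + 1) * m - ((n : ℝ) + 1) * (j + k))
            / (1 + x ^ (((n : ℝ) + 1) * m - j) * c)
          - x ^ (((n : ℝ) + 1) * (j + k)) / (1 + x ^ (k + (n : ℝ) * m) * c)))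
    = (∑' n : ℕ, x ^ (k + (((n : ℝ) + 1) + 1) * (((n : ℝ) + 1) * m - j - k)) * c
        / (1 + x ^ (((n : ℝ) + 1) * m - j) * c))
    - (∑' n : ℕ, x ^ (k + (n : ℝ) * (((n : ℝ) + 1) * m + j + k)) * c
        / (1 + x ^ (k + (n : ℝ) * m) * c)) := by
  rw [← Summable.tsum_sub
    (summable_rpow_mul_div_one_add hx0 hx1 hc (fun n : ℕ => ((n : ℝ) + 1) * m - j) fun n => ?_)
    (summable_rpow_mul_div_one_add hx0 hx1 hc (fun n : ℕ => k + (n : ℝ) * m) fun n => ?_)]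
  · refine tsum_congr fun n => ?_
    have h₁ : x ^ (k + (((n : ℝ) + 1) + 1) * (((n : ℝ) + 1) * m - j - k))
        = x ^ ((n : ℝ) * ((n : ℝ) + 1) * m - j)
          * x ^ (2 * ((n : ℝ) + 1) * m - ((n : ℝ) + 1) * (j + k)) := by
      rw [← Real.rpow_add hx0]; ring_nf
    have h₂ : x ^ (k + (n : ℝ) * (((n : ℝ) + 1) * m + j + k))
        = x ^ ((n : ℝ) * ((n : ℝ) + 1) * m - j) * x ^ (((n : ℝ) + 1) * (j + k)) := by
      rw [← Real.rpow_add hx0]; ring_nf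
    rw [h₁, h₂]
    ring
  · have hn : (0 : ℝ) ≤ n := n.cast_nonneg
    have : 1 ≤ ((n : ℝ) + 1) * m - j - k := by nlinarith
    nlinarith
  · have hn : (0 : ℝ) ≤ n := n.cast_nonneg
    have : 1 ≤ ((n : ℝ) + 1) * m + j + k := by nlinarith
    nlinarith

/-- The alternating theta-like series of the uncharged singular vectors. -/
theorem tsum_uncharged_sub {m s x : ℝ} (hs : 0 < s) (hsm : s ≤ m - 1)
    (hx0 : 0 < x) (hx1 : x < 1) :
    (∑' n : ℕ, x ^ ((n : ℝ)^2 * m) * (x ^ ((n : ℝ) * s) - x ^ (-((n : ℝ) * s))))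
    = (∑' n : ℕ, x ^ (((n : ℝ) + 1) * (((n : ℝ) + 1) * m + s)))
    - (∑' n : ℕ, x ^ (((n : ℝ) + 1) * (((n : ℝ) + 1) * m - s))) := by
  have hplus : Summable fun n : ℕ => x ^ (((n : ℝ) + 1) * (((n : ℝ) + 1) * m + s)) :=
    summable_rpow_of_natCast_le hx0 hx1 fun n => by
      have hn : (0 : ℝ) ≤ n := n.cast_nonneg
      have : 1 ≤ ((n : ℝ) + 1) * m + s := by nlinarith
      nlinarith
  have hminus : Summable fun n : ℕ => x ^ (((n : ℝ) + 1) * (((n : ℝ) + 1) * m - s)) :=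
    summable_rpow_of_natCast_le hx0 hx1 fun n => by
      have hn : (0 : ℝ) ≤ n := n.cast_nonneg
      have : 1 ≤ ((n : ℝ) + 1) * m - s := by nlinarith
      nlinarith
  have hterm (n : ℕ) : x ^ (((n + 1 : ℕ) : ℝ)^2 * m)
        * (x ^ (((n + 1 : ℕ) : ℝ) * s) - x ^ (-(((n + 1 : ℕ) : ℝ) * s)))
      = x ^ (((n : ℝ) + 1) * (((n : ℝ) + 1) * m + s))
        - x ^ (((n : ℝ) + 1) * (((n : ℝ) + 1) * m - s)) := by
    rw [mul_sub, ← Real.rpow_add hx0, ← Real.rpow_add hx0]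
    push_cast
    ring_nf
  have hshift := (hplus.sub hminus).congr fun n => (hterm n).symm
  rw [← hplus.tsum_sub hminus, ← tsum_congr hterm]
  refine (tsum_eq_zero_add' (f := fun n : ℕ =>
    x ^ ((n : ℝ)^2 * m) * (x ^ ((n : ℝ) * s) - x ^ (-((n : ℝ) * s)))) hshift).trans ?_
  simp


/-- Equation (17) of the paper: for a unitary minimal model (`j + k ≤ m - 1`), the
inclusion–exclusion sum of partition functions over the embedding diagram, divided by
the free partition function, equals the closed character formula. All powers are real
powers of `x ∈ (0,1)`. -/
theorem character_formula_identity
    (m : ℕ) (hm : 2 ≤ m) (j k : ℝ)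
    (hj : ∃ a : ℕ, j = (a : ℝ) + 1/2) (hk : ∃ b : ℕ, k = (b : ℝ) + 1/2)
    (hjk : j + k ≤ (m : ℝ) - 1)
    (x y : ℝ) (hx0 : 0 < x) (hx1 : x < 1) (hy : 0 < y) :
    1
    - (∑' n : ℕ, x ^ (k + (n : ℝ) * (((n : ℝ) + 1) * m + j + k)) * y
        / (1 + x ^ (k + (n : ℝ) * m) * y))
    - (∑' n : ℕ, x ^ (j + (n : ℝ) * (((n : ℝ) + 1) * m + j + k)) * y⁻¹
        / (1 + x ^ (j + (n : ℝ) * m) * y⁻¹))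
    - (∑' n : ℕ, x ^ (((n : ℝ) + 1) * (((n : ℝ) + 1) * m - j - k)))
    + (∑' n : ℕ, x ^ (k + (((n : ℝ) + 1) + 1) * (((n : ℝ) + 1) * m - j - k)) * y
        / (1 + x ^ (((n : ℝ) + 1) * m - j) * y))
    + (∑' n : ℕ, x ^ (j + (((n : ℝ) + 1) + 1) * (((n : ℝ) + 1) * m - j - k)) * y⁻¹
        / (1 + x ^ (((n : ℝ) + 1) * m - k) * y⁻¹))
    + (∑' n : ℕ, x ^ (((n : ℝ) + 1) * (((n : ℝ) + 1) * m + j + k)))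
    =
    1
    + (∑' n : ℕ, x ^ ((n : ℝ)^2 * m) * (x ^ ((n : ℝ) * (j + k)) - x ^ (-((n : ℝ) * (j + k)))))
    + (∑' n : ℕ, x ^ ((n : ℝ) * ((n : ℝ) + 1) * m - j) * y *
        (x ^ (2 * ((n : ℝ) + 1) * m - ((n : ℝ) + 1) * (j + k))
            / (1 + x ^ (((n : ℝ) + 1) * m - j) * y)
          - x ^ (((n : ℝ) + 1) * (j + k)) / (1 + x ^ (k + (n : ℝ) * m) * y)))
    + (∑' n : ℕ, x ^ ((n : ℝ) * ((n : ℝ) + 1) * m - k) * y⁻¹ *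
        (x ^ (2 * ((n : ℝ) + 1) * m - ((n : ℝ) + 1) * (j + k))
            / (1 + x ^ (((n : ℝ) + 1) * m - k) * y⁻¹)
          - x ^ (((n : ℝ) + 1) * (j + k)) / (1 + x ^ (j + (n : ℝ) * m) * y⁻¹))) := by
  have hj0 : 0 < j := by obtain ⟨a, rfl⟩ := hj; positivity
  have hk0 : 0 < k := by obtain ⟨b, rfl⟩ := hk; positivity
  have hθ := tsum_uncharged_sub (add_pos hj0 hk0) hjk hx0 hx1
  have hplus := tsum_charged_sub hj0 hk0 hjk hx0 hx1 hy
  have hminus := tsum_charged_sub hk0 hj0 (add_comm j k ▸ hjk) hx0 hx1 (inv_pos.mpr hy)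
  simp only [add_comm k j, sub_right_comm _ k j, add_right_comm _ k j] at hminus
  simp only [← add_assoc, ← sub_sub] at hθ hplus hminus ⊢
  rw [hθ, hplus, hminus]
  ring
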